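/- Let G be a finite group, let H ≤ A ≤ G be subgroups, and let N be a normal subgroup of G with N ≤ H. If A is a perfect code of the pair (G,H), then the quotient subgroup A/N is a perfect code of the pair (G/N, H/N). -/

import Mathlib

open scoped Pointwise

/-- A perfect code in a graph: an independent set `C` of vertices such that every
vertex outside of `C` is adjacent to exactly one vertex in `C`. -/
def IsPerfectCode {V : Type*} (Γ : SimpleGraph V) (C : Set V) : Prop :=
  (∀ a ∈ C, ∀ b ∈ C, ¬ Γ.Adj a b) ∧ ∀ v ∉ C, ∃! c, c ∈ C ∧ Γ.Adj v c

/-- A total perfect code in a graph: a set `C` of vertices such that every vertex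
of the graph is adjacent to exactly one vertex in `C`. -/
def IsTotalPerfectCode {V : Type*} (Γ : SimpleGraph V) (C : Set V) : Prop :=
  ∀ v, ∃! c, c ∈ C ∧ Γ.Adj v c

/-- The coset graph `Cos(G,H,U)`: vertices are the left cosets of `H` in `G`, and
`g₁H` is adjacent to `g₂H` iff `g₁⁻¹ * g₂ ∈ U`.  (When `HUH = U`, `H ∩ U = ∅` and
`U⁻¹ = U`, this matches the usual definition.) -/
def cosetGraph {G : Type*} [Group G] (H : Subgroup G) (U : Set G) :
    SimpleGraph (G ⧸ H) :=
  SimpleGraph.fromRel fun x y =>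
    ∃ g₁ g₂ : G, QuotientGroup.mk g₁ = x ∧ QuotientGroup.mk g₂ = y ∧ g₁⁻¹ * g₂ ∈ U

/-- `A` is a perfect code of the pair `(G,H)`: there is `U ⊆ G` with `HUH = U`,
`H ∩ U = ∅`, `U⁻¹ = U` such that `A/H = {aH : a ∈ A}` is a perfect code in the
coset graph `Cos(G,H,U)`. -/
def IsPerfectCodePair {G : Type*} [Group G] (H A : Subgroup G) : Prop :=
  ∃ U : Set G,
    (H : Set G) * U * (H : Set G) = U ∧
    (H : Set G) ∩ U = ∅ ∧
    U⁻¹ = U ∧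
    IsPerfectCode (cosetGraph H U) ((QuotientGroup.mk : G → G ⧸ H) '' (A : Set G))

/-- `A` is a total perfect code of the pair `(G,H)`. -/
def IsTotalPerfectCodePair {G : Type*} [Group G] (H A : Subgroup G) : Prop :=
  ∃ U : Set G,
    (H : Set G) * U * (H : Set G) = U ∧
    (H : Set G) ∩ U = ∅ ∧
    U⁻¹ = U ∧
    IsTotalPerfectCode (cosetGraph H U) ((QuotientGroup.mk : G → G ⧸ H) '' (A : Set G))

/-- A left transversal of `A` in `G`: a set containing exactly one element of each
left coset of `A`. -/
def IsLeftTransversal {G : Type*} [Group G] (X : Set G) (A : Subgroup G) : Prop :=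
  ∀ g : G, ∃! x, x ∈ X ∧ g⁻¹ * x ∈ A

/-- A right transversal of `A` in `G`: a set containing exactly one element of each
right coset of `A`. -/
def IsRightTransversal {G : Type*} [Group G] (Y : Set G) (A : Subgroup G) : Prop :=
  ∀ g : G, ∃! y, y ∈ Y ∧ y * g⁻¹ ∈ A

/-- A set `U` with `H * U * H = U` is stable under multiplication by `H` on both sides. -/
theorem mul_mem_of_doubleCoset_stable {G : Type*} [Group G] {H : Subgroup G} {U : Set G}
    (hU : (H : Set G) * U * (H : Set G) = U) {h k u : G} (hh : h ∈ H) (hu : u ∈ U)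
    (hk : k ∈ H) : h * u * k ∈ U := by
  rw [← hU]
  exact Set.mul_mem_mul (Set.mul_mem_mul hh hu) hk

theorem cosetGraph_adj_mk {G : Type*} [Group G] {H : Subgroup G} {U : Set G}
    (hU : (H : Set G) * U * (H : Set G) = U) (hHU : (H : Set G) ∩ U = ∅) (hinv : U⁻¹ = U)
    (a b : G) :
    (cosetGraph H U).Adj (QuotientGroup.mk a) (QuotientGroup.mk b) ↔ a⁻¹ * b ∈ U := by
  have key : ∀ a b : G, (∃ g₁ g₂ : G, (QuotientGroup.mk g₁ : G ⧸ H) = QuotientGroup.mk a ∧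
      (QuotientGroup.mk g₂ : G ⧸ H) = QuotientGroup.mk b ∧ g₁⁻¹ * g₂ ∈ U) ↔ a⁻¹ * b ∈ U := by
    refine fun a b => ⟨?_, fun h => ⟨a, b, rfl, rfl, h⟩⟩
    rintro ⟨g₁, g₂, h₁, h₂, hg⟩
    have := mul_mem_of_doubleCoset_stable hU (QuotientGroup.eq.1 h₁.symm) hg
      (QuotientGroup.eq.1 h₂)
    simpa [mul_assoc] using this
  have hsymm : b⁻¹ * a ∈ U ↔ a⁻¹ * b ∈ U := by
    rw [← Set.inv_mem_inv, hinv, mul_inv_rev, inv_inv]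
  rw [cosetGraph, SimpleGraph.fromRel_adj, key, key, hsymm, or_self, and_iff_right_iff_imp,
    Ne, QuotientGroup.eq]
  exact fun h h' => (hHU ▸ (⟨h', h⟩ : a⁻¹ * b ∈ (H : Set G) ∩ U) : a⁻¹ * b ∈ (∅ : Set G))

theorem mk_mem_image_mk_iff {G : Type*} [Group G] {H A : Subgroup G} (hHA : H ≤ A) (g : G) :
    (QuotientGroup.mk g : G ⧸ H) ∈ (QuotientGroup.mk : G → G ⧸ H) '' (A : Set G) ↔ g ∈ A := by
  refine ⟨?_, fun h => ⟨g, h, rfl⟩⟩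
  rintro ⟨a, ha, h⟩
  simpa using A.mul_mem ha (hHA (QuotientGroup.eq.1 h))

/-- The perfect code condition for `A/H` in `Cos(G,H,U)`, in terms of elements of `G`. -/
theorem isPerfectCode_cosetGraph_iff {G : Type*} [Group G] {H A : Subgroup G} {U : Set G}
    (hHA : H ≤ A) (hU : (H : Set G) * U * (H : Set G) = U) (hHU : (H : Set G) ∩ U = ∅)
    (hinv : U⁻¹ = U) :
    IsPerfectCode (cosetGraph H U) ((QuotientGroup.mk : G → G ⧸ H) '' (A : Set G)) ↔
      (∀ a ∈ A, ∀ b ∈ A, a⁻¹ * b ∉ U) ∧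
        ∀ g ∉ A, ∃ a ∈ A, g⁻¹ * a ∈ U ∧ ∀ b ∈ A, g⁻¹ * b ∈ U → b⁻¹ * a ∈ H := by
  have hadj := cosetGraph_adj_mk hU hHU hinv
  refine and_congr ?_ ?_
  · simp only [Set.forall_mem_image, SetLike.mem_coe, hadj]
  · rw [(QuotientGroup.mk_surjective (s := H)).forall]
    simp only [mk_mem_image_mk_iff hHA, ExistsUnique,
      (QuotientGroup.mk_surjective (s := H)).exists,
      (QuotientGroup.mk_surjective (s := H)).forall, hadj, QuotientGroup.eq, and_imp, and_assoc]

theorem mk'_mem_map_iff {G : Type*} [Group G] {K N : Subgroup G} [N.Normal] (hNK : N ≤ K)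
    (g : G) : QuotientGroup.mk' N g ∈ K.map (QuotientGroup.mk' N) ↔ g ∈ K := by
  rw [← Subgroup.mem_comap, Subgroup.comap_map_eq, QuotientGroup.ker_mk', sup_eq_left.2 hNK]

theorem mk'_mem_image_iff {G : Type*} [Group G] {H N : Subgroup G} [N.Normal] {U : Set G}
    (hNH : N ≤ H) (hU : (H : Set G) * U * (H : Set G) = U) (g : G) :
    QuotientGroup.mk' N g ∈ QuotientGroup.mk' N '' U ↔ g ∈ U := by
  refine ⟨?_, Set.mem_image_of_mem _⟩
  rintro ⟨u, hu, h⟩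
  simpa using mul_mem_of_doubleCoset_stable hU H.one_mem hu (hNH (QuotientGroup.eq.1 h))

/-- if `N ⊴ G`, `N ≤ H ≤ A` and `A` is a perfect code of `(G,H)`, then
`A/N` is a perfect code of `(G/N, H/N)`. -/
theorem perfectCodePair_quotient
    {G : Type*} [Group G] [Finite G] (H A N : Subgroup G) [N.Normal]
    (hNH : N ≤ H) (hHA : H ≤ A) (h : IsPerfectCodePair H A) :
    IsPerfectCodePair (H.map (QuotientGroup.mk' N)) (A.map (QuotientGroup.mk' N)) := by
  obtain ⟨U, hU, hHU, hinv, hcode⟩ := h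
  have hmemH := mk'_mem_map_iff hNH
  have hmemA := mk'_mem_map_iff (hNH.trans hHA)
  have hmemU := mk'_mem_image_iff hNH hU
  have hsurj := QuotientGroup.mk'_surjective N
  have hU' : (H.map (QuotientGroup.mk' N) : Set (G ⧸ N)) * (QuotientGroup.mk' N '' U) *
      (H.map (QuotientGroup.mk' N) : Set (G ⧸ N)) = QuotientGroup.mk' N '' U := by
    rw [Subgroup.coe_map, ← Set.image_mul, ← Set.image_mul, hU]
  have hHU' : (H.map (QuotientGroup.mk' N) : Set (G ⧸ N)) ∩ (QuotientGroup.mk' N '' U) = ∅ := by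
    rw [Set.eq_empty_iff_forall_notMem, hsurj.forall]
    intro x hx
    rw [Set.mem_inter_iff, SetLike.mem_coe, hmemH, hmemU] at hx
    exact Set.eq_empty_iff_forall_notMem.1 hHU x hx
  have hinv' : (QuotientGroup.mk' N '' U)⁻¹ = QuotientGroup.mk' N '' U := by
    ext x
    obtain ⟨x, rfl⟩ := hsurj x
    rw [Set.mem_inv, ← map_inv, hmemU, hmemU, ← Set.mem_inv, hinv]
  refine ⟨QuotientGroup.mk' N '' U, hU', hHU', hinv', ?_⟩
  rw [isPerfectCode_cosetGraph_iff hHA hU hHU hinv] at hcode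
  rw [isPerfectCode_cosetGraph_iff (Subgroup.map_mono hHA) hU' hHU' hinv']
  simpa only [hsurj.forall, hsurj.exists, ← map_inv, ← map_mul, hmemA, hmemU, hmemH] using hcode
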